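/- arXiv:1111.1357 — 2 statements merged into one kernel-verified Lean document; each statement's English description precedes it below -/
import Mathlib

section
/- Let a, b, c ∈ ℝ² be points with R = |a − c| ≤ |b − c| ≤ T = |a − b| and a ≠ b, a ≠ c, and let θ be the angle at vertex a of the triangle abc (the angle between the vectors b − a and c − a). Then |b − c| − (T − R) ≤ 2R(1 − cos θ) ≤ R·θ². -/
theorem triangle_gap_estimate (a b c : EuclideanSpace ℝ (Fin 2))
    (hab : a ≠ b) (hac : a ≠ c)
    (h1 : dist a c ≤ dist b c) (h2 : dist b c ≤ dist a b) :
    dist b c - (dist a b - dist a c) ≤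
        2 * dist a c * (1 - Real.cos (EuclideanGeometry.angle b a c)) ∧
      2 * dist a c * (1 - Real.cos (EuclideanGeometry.angle b a c)) ≤
        dist a c * (EuclideanGeometry.angle b a c) ^ 2 := by
  have law := EuclideanGeometry.law_cos b a c
  have tri := dist_triangle_right a b c
  have hT : 0 < dist a b := dist_pos.mpr hab
  rw [dist_comm b a, dist_comm c a] at law
  constructor
  · refine le_of_mul_le_mul_right ?_ hT
    nlinarith [mul_nonneg (by linarith : 0 ≤ dist b c - (dist a b - dist a c))
      (sub_nonneg.mpr h1)]
  · nlinarith [mul_le_mul_of_nonneg_left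
      (Real.one_sub_sq_div_two_le_cos (x := EuclideanGeometry.angle b a c))
      (dist_nonneg (x := a) (y := c))]
end

section
/- There exist absolute constants C > 0 and R₀ > 0 with the following property: if r and s are zeros of f with R₀ ≤ r ≤ s, where f(r) = ∫_D exp(−2πi r x₁) dx is the Fourier transform of the indicator of the closed unit disk D evaluated at (r, 0), then there exists a nonnegative integer j such that |(s − r) − j/2| ≤ C·(s − r + 1)/r². -/
open MeasureTheory

/-- The closed unit disk in the plane. -/
noncomputable def unitDisk : Set (EuclideanSpace ℝ (Fin 2)) := {x | ‖x‖ ≤ 1}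

/-- The Fourier transform of the indicator of the closed unit disk, restricted to
the positive horizontal axis: `f r = ∫_D exp(-2πi r x₁) dx`. -/
noncomputable def fDisk (r : ℝ) : ℂ :=
  ∫ x in unitDisk, Complex.exp (-(2 * Real.pi * Complex.I) * (r : ℂ) * ((x 0 : ℝ) : ℂ))

/-- Differentiation of `r ↦ ∫ w(t) h(rt) dt` under the integral sign. -/
lemma hasDerivAt_integral_mul_comp {w h h' : ℝ → ℝ} {B : ℝ} (hw : Continuous w)
    (hh : ∀ x, HasDerivAt h (h' x) x) (hh' : Continuous h') (hB : ∀ x, |h' x| ≤ B) (r : ℝ) :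
    HasDerivAt (fun r => ∫ t in (-1 : ℝ)..1, w t * h (r * t))
      (∫ t in (-1 : ℝ)..1, w t * t * h' (r * t)) r := by
  have hc : Continuous h := continuous_iff_continuousAt.2 fun x => (hh x).continuousAt
  refine (intervalIntegral.hasDerivAt_integral_of_dominated_loc_of_deriv_le
    (F := fun r t => w t * h (r * t)) (F' := fun r t => w t * t * h' (r * t))
    (bound := fun t => |w t * t| * B) (s := Set.univ) Filter.univ_mem
    (Filter.Eventually.of_forall fun x => ?_) ?_ ?_ ?_ ?_ ?_).2
  · exact (by fun_prop : Continuous fun t => w t * h (x * t)).aestronglyMeasurable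
  · exact (by fun_prop : Continuous fun t => w t * h (r * t)).intervalIntegrable _ _
  · exact (by fun_prop : Continuous fun t => w t * t * h' (r * t)).aestronglyMeasurable
  · refine Filter.Eventually.of_forall fun t _ x _ => ?_
    rw [Real.norm_eq_abs, abs_mul]
    exact mul_le_mul_of_nonneg_left (hB _) (abs_nonneg _)
  · exact (by fun_prop : Continuous fun t => |w t * t| * B).intervalIntegrable _ _
  · refine Filter.Eventually.of_forall fun t _ x _ => ?_
    have h1 : HasDerivAt (fun x : ℝ => x * t) t x := by simpa using (hasDerivAt_id x).mul_const t
    have h2 := ((hh (x * t)).comp x h1).const_mul (w t)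
    exact h2.congr_deriv (by ring)

lemma setIntegral_unitDisk_eq {h : ℝ → ℝ} (hh : Continuous h) :
    ∫ x in unitDisk, h (x 0) = ∫ t in (-1 : ℝ)..1, 2 * √(1 - t ^ 2) * h t := by
  have hD : unitDisk = Metric.closedBall 0 1 := by ext x; simp [unitDisk]
  have hDm : MeasurableSet unitDisk := hD ▸ Metric.isClosed_closedBall.measurableSet
  let S : Set (ℝ × ℝ) := {p | p.1 ^ 2 + p.2 ^ 2 ≤ 1}
  have hSc : IsClosed S := isClosed_le (by fun_prop) (by fun_prop)
  have hSm : MeasurableSet S := hSc.measurableSet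
  have hScpt : IsCompact S := by
    refine (isCompact_Icc (a := ((-1, -1) : ℝ × ℝ)) (b := (1, 1))).of_isClosed_subset hSc ?_
    rintro ⟨a, b⟩ (hab : a ^ 2 + b ^ 2 ≤ 1)
    simp only [Set.mem_Icc, Prod.mk_le_mk]
    refine ⟨⟨?_, ?_⟩, ?_, ?_⟩ <;> nlinarith [sq_nonneg a, sq_nonneg b]
  have hint : Integrable (S.indicator fun p : ℝ × ℝ => h p.1) := by
    rw [integrable_indicator_iff hSm]
    exact (by fun_prop : Continuous fun p : ℝ × ℝ => h p.1).continuousOn.integrableOn_compact hScpt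
  have hmp := (volume_preserving_finTwoArrow ℝ).comp
    (EuclideanSpace.volume_preserving_symm_measurableEquiv_toLp (Fin 2))
  have h1 : ∫ x in unitDisk, h (x 0) = ∫ p, S.indicator (fun p : ℝ × ℝ => h p.1) p := by
    rw [← integral_indicator hDm, ← hmp.integral_comp
      ((MeasurableEquiv.finTwoArrow).measurableEmbedding.comp
        (MeasurableEquiv.toLp 2 (Fin 2 → ℝ)).symm.measurableEmbedding)]
    congr 1
    ext x
    have : x ∈ unitDisk ↔ (x 0) ^ 2 + (x 1) ^ 2 ≤ 1 := by
      simp [unitDisk, EuclideanSpace.norm_eq, Fin.sum_univ_two]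
    by_cases hx : (x 0) ^ 2 + (x 1) ^ 2 ≤ 1
    · rw [Set.indicator_of_mem (this.2 hx), Set.indicator_of_mem (by exact hx)]; rfl
    · rw [Set.indicator_of_notMem (mt this.1 hx), Set.indicator_of_notMem (by exact hx)]
  have h2 (t : ℝ) : ∫ y, S.indicator (fun p : ℝ × ℝ => h p.1) (t, y) =
      (Set.Icc (-1 : ℝ) 1).indicator (fun t => 2 * √(1 - t ^ 2) * h t) t := by
    by_cases ht : t ∈ Set.Icc (-1 : ℝ) 1
    · have hnn : 0 ≤ 1 - t ^ 2 := by nlinarith [ht.1, ht.2]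
      have : (fun y => S.indicator (fun p : ℝ × ℝ => h p.1) (t, y)) =
          (Set.Icc (-√(1 - t ^ 2)) (√(1 - t ^ 2))).indicator fun _ => h t := by
        ext y
        have hiff : (t, y) ∈ S ↔ y ∈ Set.Icc (-√(1 - t ^ 2)) (√(1 - t ^ 2)) := by
          rw [Set.mem_Icc, ← abs_le, Real.le_sqrt (abs_nonneg y) hnn, sq_abs]
          change t ^ 2 + y ^ 2 ≤ 1 ↔ _
          constructor <;> intro _ <;> linarith
        by_cases hy : (t, y) ∈ S
        · rw [Set.indicator_of_mem hy, Set.indicator_of_mem (hiff.1 hy)]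
        · rw [Set.indicator_of_notMem hy, Set.indicator_of_notMem (mt hiff.2 hy)]
      rw [this, integral_indicator measurableSet_Icc, Set.indicator_of_mem ht]
      simp only [measureReal_restrict_apply_univ, integral_const, Real.volume_real_Icc, smul_eq_mul]
      rw [max_eq_left (by linarith [Real.sqrt_nonneg (1 - t ^ 2)])]
      ring
    · have : ∀ y, (t, y) ∉ S := by
        rintro y (hy : t ^ 2 + y ^ 2 ≤ 1)
        exact ht ⟨by nlinarith [sq_nonneg y], by nlinarith [sq_nonneg y]⟩
      simp [Set.indicator_of_notMem ht, Set.indicator_of_notMem (this _)]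
  rw [h1, Measure.volume_eq_prod, integral_prod _ hint]
  simp only [h2]
  rw [integral_indicator measurableSet_Icc, integral_Icc_eq_integral_Ioc,
    intervalIntegral.integral_of_le (by norm_num)]

/-- The Fourier transform of the disk as a one-dimensional real integral. -/
noncomputable def diskCosIntegral (r : ℝ) : ℝ :=
  ∫ t in (-1 : ℝ)..1, 2 * √(1 - t ^ 2) * Real.cos (2 * Real.pi * (r * t))

/-- The first derivative of `diskCosIntegral`. -/
noncomputable def diskCosIntegralDeriv (r : ℝ) : ℝ :=
  ∫ t in (-1 : ℝ)..1, 2 * √(1 - t ^ 2) * t * (-(2 * Real.pi) * Real.sin (2 * Real.pi * (r * t)))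

lemma diskCosIntegral_eq_zero_of_fDisk_eq_zero {r : ℝ} (hr : fDisk r = 0) :
    diskCosIntegral r = 0 := by
  have hD : unitDisk = Metric.closedBall 0 1 := by ext x; simp [unitDisk]
  have hint : IntegrableOn (fun x : EuclideanSpace ℝ (Fin 2) =>
      Complex.exp (-(2 * Real.pi * Complex.I) * (r : ℂ) * ((x 0 : ℝ) : ℂ))) unitDisk := by
    rw [hD]
    exact (by fun_prop : Continuous _).continuousOn.integrableOn_compact
      (isCompact_closedBall _ _)
  have h1 := congrArg Complex.re hr
  rw [fDisk, Complex.zero_re, ← RCLike.re_eq_complex_re, ← integral_re hint] at h1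
  rw [diskCosIntegral, ← setIntegral_unitDisk_eq (h := fun t => Real.cos (2 * Real.pi * (r * t)))
    (by fun_prop), ← h1]
  congr 1
  ext x
  rw [RCLike.re_eq_complex_re, Complex.exp_re]
  simp [mul_assoc]

lemma hasDerivAt_cos_two_pi_mul (x : ℝ) : HasDerivAt (fun x => Real.cos (2 * Real.pi * x))
    (-(2 * Real.pi) * Real.sin (2 * Real.pi * x)) x := by
  have h := (Real.hasDerivAt_cos (2 * Real.pi * x)).comp x
    ((hasDerivAt_id x).const_mul (2 * Real.pi))
  exact h.congr_deriv (by ring)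

lemma hasDerivAt_sin_two_pi_mul (x : ℝ) :
    HasDerivAt (fun x => -(2 * Real.pi) * Real.sin (2 * Real.pi * x))
      (-(2 * Real.pi) ^ 2 * Real.cos (2 * Real.pi * x)) x := by
  have h := ((Real.hasDerivAt_sin (2 * Real.pi * x)).comp x
    ((hasDerivAt_id x).const_mul (2 * Real.pi))).const_mul (-(2 * Real.pi))
  exact h.congr_deriv (by ring)

lemma hasDerivAt_diskCosIntegral (r : ℝ) :
    HasDerivAt diskCosIntegral (diskCosIntegralDeriv r) r := by
  refine hasDerivAt_integral_mul_comp (B := 2 * Real.pi) (by fun_prop) hasDerivAt_cos_two_pi_mul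
    (by fun_prop) (fun x => ?_) r
  rw [abs_mul, abs_neg, abs_of_pos Real.two_pi_pos]
  exact mul_le_of_le_one_right Real.two_pi_pos.le (Real.abs_sin_le_one _)

/-- Bessel's equation for the Fourier transform of the disk. -/
lemma hasDerivAt_diskCosIntegralDeriv {r : ℝ} (hr : r ≠ 0) :
    HasDerivAt diskCosIntegralDeriv
      (-(3 / r) * diskCosIntegralDeriv r - (2 * Real.pi) ^ 2 * diskCosIntegral r) r := by
  have h := hasDerivAt_integral_mul_comp (w := fun t => 2 * √(1 - t ^ 2) * t)
    (B := (2 * Real.pi) ^ 2) (by fun_prop) hasDerivAt_sin_two_pi_mul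
    (by fun_prop) (fun x => by
      rw [abs_mul, abs_neg, abs_of_pos (by positivity)]
      exact mul_le_of_le_one_right (by positivity) (Real.abs_cos_le_one _)) r
  refine h.congr_deriv ?_
  have hparts : ∫ t in (-1 : ℝ)..1,
      (3 * (2 * √(1 - t ^ 2) * t * (-(2 * Real.pi) * Real.sin (2 * Real.pi * (r * t))))
      + r * (2 * Real.pi) ^ 2 * (2 * √(1 - t ^ 2) * Real.cos (2 * Real.pi * (r * t)))
      + r * (2 * √(1 - t ^ 2) * t * t *
        (-(2 * Real.pi) ^ 2 * Real.cos (2 * Real.pi * (r * t))))) = 0 := by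
    rw [intervalIntegral.integral_eq_sub_of_hasDerivAt_of_le
      (f := fun t => -(2 * ((1 - t ^ 2) * √(1 - t ^ 2)) *
        (-(2 * Real.pi) * Real.sin (2 * Real.pi * (r * t))))) (by norm_num) (by fun_prop)]
    · simp
    · intro t ht
      have hpos : 0 < 1 - t ^ 2 := by nlinarith [ht.1, ht.2]
      have hp : HasDerivAt (fun t : ℝ => 1 - t ^ 2) (-(2 * t)) t := by
        simpa using (hasDerivAt_pow 2 t).const_sub 1
      have hw := (hp.mul (hp.sqrt hpos.ne')).const_mul 2
      have h1 : HasDerivAt (fun t : ℝ => r * t) r t := by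
        simpa using (hasDerivAt_id t).const_mul r
      refine (hw.mul ((hasDerivAt_sin_two_pi_mul (r * t)).comp t h1)).neg.congr_deriv ?_
      have hs : √(1 - t ^ 2) ≠ 0 := (Real.sqrt_pos.2 hpos).ne'
      have hss : √(1 - t ^ 2) ^ 2 = 1 - t ^ 2 := Real.sq_sqrt hpos.le
      have hd : (1 - t ^ 2) * (-(2 * t) / (2 * √(1 - t ^ 2))) = -t * √(1 - t ^ 2) := by
        nth_rewrite 1 [← hss]
        field_simp
      simp only [Pi.mul_apply, Function.comp_apply]
      rw [hd]
      ring
    · exact (by fun_prop : Continuous _).intervalIntegrable _ _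
  rw [intervalIntegral.integral_add, intervalIntegral.integral_add,
    intervalIntegral.integral_const_mul, intervalIntegral.integral_const_mul,
    intervalIntegral.integral_const_mul] at hparts
  · change 3 * diskCosIntegralDeriv r + r * (2 * Real.pi) ^ 2 * diskCosIntegral r + _ = 0 at hparts
    apply mul_left_cancel₀ hr
    have : r * (-(3 / r) * diskCosIntegralDeriv r - (2 * Real.pi) ^ 2 * diskCosIntegral r) =
      -3 * diskCosIntegralDeriv r - r * (2 * Real.pi) ^ 2 * diskCosIntegral r := by
      field_simp
    rw [this]
    linarith
  all_goals exact (by fun_prop : Continuous _).intervalIntegrable _ _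

lemma diskCosIntegral_zero : diskCosIntegral 0 = Real.pi := by
  simp [diskCosIntegral, integral_sqrt_one_sub_sq]
  ring

/-- All zeros of `diskCosIntegral` on the positive axis are simple. -/
lemma diskCosIntegralDeriv_ne_zero {s : ℝ} (hs : 0 < s) (h0 : diskCosIntegral s = 0) :
    diskCosIntegralDeriv s ≠ 0 := by
  intro h1
  let F : ℝ → ℝ := fun x =>
    x ^ 6 * (diskCosIntegralDeriv x ^ 2 + (2 * Real.pi) ^ 2 * diskCosIntegral x ^ 2)
  have hF : ∀ x, 0 < x → HasDerivAt F
      (6 * x ^ 5 * ((2 * Real.pi) ^ 2 * diskCosIntegral x ^ 2)) x := by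
    intro x hx
    have h := (hasDerivAt_pow 6 x).mul (((hasDerivAt_diskCosIntegralDeriv hx.ne').pow 2).add
      (((hasDerivAt_diskCosIntegral x).pow 2).const_mul ((2 * Real.pi) ^ 2)))
    refine h.congr_deriv ?_
    simp only [Pi.add_apply, Pi.pow_apply]
    field_simp
    push_cast
    ring
  have hmono : MonotoneOn F (Set.Ioi 0) := by
    refine monotoneOn_of_deriv_nonneg (convex_Ioi 0)
      (fun x hx => (hF x hx).continuousAt.continuousWithinAt)
      (fun x hx => (hF x (by simpa using hx)).differentiableAt.differentiableWithinAt)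
      fun x hx => ?_
    have hx : 0 < x := by simpa using hx
    rw [(hF x hx).deriv]
    positivity
  have hzero : ∀ x ∈ Set.Ioo 0 s, diskCosIntegral x = 0 := by
    intro x hx
    have h2 : F x ≤ F s := hmono hx.1 hs hx.2.le
    have h3 : F s = 0 := by simp [F, h0, h1]
    have hx0 := hx.1
    by_contra hne
    have : 0 < F x := by positivity
    linarith
  have hcont : ContinuousWithinAt diskCosIntegral (Set.Ioi 0) 0 :=
    (hasDerivAt_diskCosIntegral 0).continuousAt.continuousWithinAt
  have hlim : Filter.Tendsto diskCosIntegral (nhdsWithin 0 (Set.Ioi 0)) (nhds 0) :=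
    tendsto_const_nhds.congr' (by
      filter_upwards [Ioo_mem_nhdsGT hs] with x hx using (hzero x hx).symm)
  have := tendsto_nhds_unique hcont.tendsto hlim
  rw [diskCosIntegral_zero] at this
  exact Real.pi_ne_zero this

/-- The complex Prüfer variable of `r ^ (3 / 2) * diskCosIntegral r`, with the free rotation
removed. -/
noncomputable def prueferVar (x : ℝ) : ℂ :=
  Complex.exp (-(2 * Real.pi * x : ℝ) * Complex.I) *
    (((x ^ (3 / 2 : ℝ) * (diskCosIntegralDeriv x + 3 / (2 * x) * diskCosIntegral x) : ℝ) : ℂ) +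
      ((x ^ (3 / 2 : ℝ) * (2 * Real.pi * diskCosIntegral x) : ℝ) : ℂ) * Complex.I)

lemma norm_prueferVar_ge {x : ℝ} (hx : 0 < x) :
    x ^ (3 / 2 : ℝ) * (2 * Real.pi * |diskCosIntegral x|) ≤ ‖prueferVar x‖ := by
  have h1 : ‖Complex.exp (-(2 * Real.pi * x : ℝ) * Complex.I)‖ = 1 := by
    rw [← Complex.ofReal_neg, Complex.norm_exp_ofReal_mul_I]
  rw [prueferVar, norm_mul, h1, one_mul]
  refine le_trans (le_of_eq ?_) (Complex.abs_im_le_norm _)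
  rw [Complex.add_im, Complex.ofReal_im, zero_add, Complex.mul_I_im, Complex.ofReal_re, abs_mul,
    abs_mul, abs_of_pos Real.two_pi_pos, abs_of_pos (Real.rpow_pos_of_pos hx _)]

lemma hasDerivAt_prueferVar {x : ℝ} (hx : 0 < x) :
    HasDerivAt prueferVar (Complex.exp (-(2 * Real.pi * x : ℝ) * Complex.I) *
      ((x ^ (3 / 2 : ℝ) * (3 / (4 * x ^ 2) * diskCosIntegral x) : ℝ) : ℂ)) x := by
  have hp : HasDerivAt (fun x : ℝ => x ^ (3 / 2 : ℝ)) (3 / (2 * x) * x ^ (3 / 2 : ℝ)) x := by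
    refine (Real.hasDerivAt_rpow_const (Or.inl hx.ne')).congr_deriv ?_
    rw [Real.rpow_sub_one hx.ne']
    field_simp
  have hq : HasDerivAt (fun x : ℝ => 3 / (2 * x)) (-(3 / (2 * x ^ 2))) x := by
    have := ((hasDerivAt_inv hx.ne').const_mul (3 / 2 : ℝ))
    refine (this.congr_deriv (by field_simp)).congr_of_eventuallyEq ?_
    exact Filter.Eventually.of_forall fun y => by simp only [div_eq_mul_inv, mul_inv]; ring
  have hg := hasDerivAt_diskCosIntegral x
  have hA := (hp.mul ((hasDerivAt_diskCosIntegralDeriv hx.ne').add (hq.mul hg))).ofReal_comp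
  have hB := (hp.mul (hg.const_mul (2 * Real.pi))).ofReal_comp.mul_const Complex.I
  have hl : HasDerivAt (fun x : ℝ => (2 * Real.pi * x : ℝ)) (2 * Real.pi) x := by
    simpa using (hasDerivAt_id x).const_mul (2 * Real.pi)
  have hE := (hl.ofReal_comp.neg.mul_const Complex.I).cexp
  refine (hE.mul (hA.add hB)).congr_deriv ?_
  simp only [Pi.add_apply, Pi.mul_apply, Pi.neg_apply]
  have hxc : (x : ℂ) ≠ 0 := by exact_mod_cast hx.ne'
  push_cast
  field_simp
  ring_nf
  simp only [Complex.I_sq]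
  ring

lemma norm_deriv_prueferVar_le {x : ℝ} (hx : 0 < x) :
    ‖Complex.exp (-(2 * Real.pi * x : ℝ) * Complex.I) *
      ((x ^ (3 / 2 : ℝ) * (3 / (4 * x ^ 2) * diskCosIntegral x) : ℝ) : ℂ)‖ ≤
      ‖prueferVar x‖ / (8 * x ^ 2) := by
  have h1 : ‖Complex.exp (-(2 * Real.pi * x : ℝ) * Complex.I)‖ = 1 := by
    rw [← Complex.ofReal_neg, Complex.norm_exp_ofReal_mul_I]
  rw [norm_mul, h1, one_mul, Complex.norm_real, Real.norm_eq_abs, abs_mul, abs_mul,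
    abs_of_pos (Real.rpow_pos_of_pos hx _), abs_of_pos (by positivity : 0 < 3 / (4 * x ^ 2)),
    le_div_iff₀ (by positivity)]
  refine le_trans ?_ (norm_prueferVar_ge hx)
  have h2 : x ^ (3 / 2 : ℝ) * (3 / (4 * x ^ 2) * |diskCosIntegral x|) * (8 * x ^ 2) =
      x ^ (3 / 2 : ℝ) * (6 * |diskCosIntegral x|) := by
    field_simp
    ring
  rw [h2]
  gcongr
  linarith [Real.pi_gt_three]

lemma exists_nat_abs_sub_half_le {d : ℝ} (hd : 0 ≤ d) :
    ∃ j : ℕ, |d - (j : ℝ) / 2| ≤ 1 / 4 ∧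
      4 * |d - (j : ℝ) / 2| ≤ |Real.sin (2 * Real.pi * d)| := by
  have hj0 : 0 ≤ round (2 * d) := by
    rw [round_eq]; exact Int.floor_nonneg.2 (by linarith)
  obtain ⟨j, hj⟩ := Int.eq_ofNat_of_zero_le hj0
  have h1 := abs_sub_round (2 * d)
  rw [hj, Int.cast_natCast] at h1
  have h2 : |2 * d - j| = 2 * |d - (j : ℝ) / 2| := by
    rw [← abs_two (α := ℝ), ← abs_mul, abs_two]; congr 1; ring
  refine ⟨j, by linarith, ?_⟩
  have h3 : |Real.sin (2 * Real.pi * d)| = |Real.sin (2 * Real.pi * (d - (j : ℝ) / 2))| := by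
    rw [show 2 * Real.pi * (d - (j : ℝ) / 2) = 2 * Real.pi * d - j * Real.pi by ring,
      Real.sin_sub_nat_mul_pi, abs_mul, abs_pow, abs_neg, abs_one, one_pow, one_mul]
  have h4 : |2 * Real.pi * (d - (j : ℝ) / 2)| = 2 * Real.pi * |d - (j : ℝ) / 2| := by
    rw [abs_mul, abs_of_pos Real.two_pi_pos]
  have h5 := Real.mul_abs_le_abs_sin (x := 2 * Real.pi * (d - (j : ℝ) / 2)) (by
    rw [h4]; nlinarith [Real.pi_pos])
  rw [h3]
  refine le_trans (le_of_eq ?_) h5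
  rw [h4]
  field_simp
  ring

lemma abs_sin_zero_sub_le {r s : ℝ} (hr : 0 < r) (hrs : r ≤ s) (hgr : diskCosIntegral r = 0)
    (hgs : diskCosIntegral s = 0) (hsmall : s - r ≤ r ^ 2) :
    |Real.sin (2 * Real.pi * (s - r))| ≤ (s - r) / r ^ 2 := by
  have hs : 0 < s := hr.trans_le hrs
  obtain ⟨m, hm, hmax⟩ := isCompact_Icc.exists_isMaxOn (Set.nonempty_Icc.2 hrs)
    (f := fun x => ‖prueferVar x‖) (fun x hx =>
      (hasDerivAt_prueferVar (hr.trans_le hx.1)).continuousAt.norm.continuousWithinAt)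
  set M := ‖prueferVar m‖ with hM
  have hlip : ∀ x ∈ Set.Icc r s, ∀ y ∈ Set.Icc r s,
      ‖prueferVar y - prueferVar x‖ ≤ M / (8 * r ^ 2) * ‖y - x‖ := by
    intro x hx y hy
    refine (convex_Icc r s).norm_image_sub_le_of_norm_hasDerivWithin_le
      (fun z hz => (hasDerivAt_prueferVar (hr.trans_le hz.1)).hasDerivWithinAt) (fun z hz => ?_)
      hx hy
    refine (norm_deriv_prueferVar_le (hr.trans_le hz.1)).trans ?_
    have h1 : ‖prueferVar z‖ ≤ M := hmax hz
    have h2 := hz.1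
    gcongr
  have hrI : r ∈ Set.Icc r s := Set.left_mem_Icc.2 hrs
  have hsI : s ∈ Set.Icc r s := Set.right_mem_Icc.2 hrs
  have hlip' : ∀ x ∈ Set.Icc r s, ‖prueferVar s - prueferVar x‖ ≤ M * ((s - r) / r ^ 2) / 8 := by
    intro x hx
    refine (hlip x hx s hsI).trans ?_
    have h1 : ‖s - x‖ ≤ s - r := by
      rw [Real.norm_eq_abs, abs_of_nonneg (by linarith [hx.2])]; linarith [hx.1]
    calc M / (8 * r ^ 2) * ‖s - x‖ ≤ M / (8 * r ^ 2) * (s - r) := by gcongr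
      _ = _ := by field_simp
  set δ := (s - r) / r ^ 2 with hδ
  have hδ0 : 0 ≤ δ := div_nonneg (by linarith) (by positivity)
  have hδ1 : δ ≤ 1 := (div_le_one (by positivity)).2 hsmall
  have hM0 : 0 ≤ M := norm_nonneg _
  let A : ℝ := r ^ (3 / 2 : ℝ) * diskCosIntegralDeriv r
  let B : ℝ := s ^ (3 / 2 : ℝ) * diskCosIntegralDeriv s
  have hA : prueferVar r = Complex.exp (-(2 * Real.pi * r : ℝ) * Complex.I) * (A : ℂ) := by
    simp [prueferVar, hgr, A]
  have hB : prueferVar s = Complex.exp (-(2 * Real.pi * s : ℝ) * Complex.I) * (B : ℂ) := by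
    simp [prueferVar, hgs, B]
  have hnB : ‖prueferVar s‖ = |B| := by
    rw [hB, norm_mul, ← Complex.ofReal_neg, Complex.norm_exp_ofReal_mul_I, one_mul,
      Complex.norm_real, Real.norm_eq_abs]
  have hBpos : 0 < |B| := abs_pos.2
    (mul_ne_zero (Real.rpow_pos_of_pos hs _).ne' (diskCosIntegralDeriv_ne_zero hs hgs))
  have hMB : M ≤ 8 * |B| := by
    have h1 := norm_sub_norm_le (prueferVar m) (prueferVar s)
    rw [norm_sub_rev, hnB] at h1
    have h2 := hlip' m hm
    have h3 : M * δ ≤ M := mul_le_of_le_one_right hM0 hδ1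
    linarith
  have hsin : |Real.sin (2 * Real.pi * (s - r))| * |B| ≤ ‖prueferVar s - prueferVar r‖ := by
    have h1 : ‖prueferVar s - prueferVar r‖ =
        ‖Complex.exp (((-(2 * Real.pi * (s - r)) : ℝ) : ℂ) * Complex.I) * (B : ℂ) - (A : ℂ)‖ := by
      have h2 : prueferVar s - prueferVar r =
          Complex.exp (((-(2 * Real.pi * r) : ℝ) : ℂ) * Complex.I) *
          (Complex.exp (((-(2 * Real.pi * (s - r)) : ℝ) : ℂ) * Complex.I) * (B : ℂ) - (A : ℂ)) := by
        rw [hA, hB, mul_sub, ← mul_assoc, ← Complex.exp_add]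
        congr 3 <;> push_cast <;> ring_nf
      rw [h2, norm_mul, Complex.norm_exp_ofReal_mul_I, one_mul]
    rw [h1]
    refine le_trans (le_of_eq ?_) (Complex.abs_im_le_norm _)
    rw [Complex.sub_im, Complex.im_mul_ofReal, Complex.exp_ofReal_mul_I_im, Complex.ofReal_im,
      sub_zero, Real.sin_neg, neg_mul, abs_neg, abs_mul (Real.sin _)]
  have h1 := hsin.trans (hlip' r hrI)
  have h2 : M * δ ≤ 8 * |B| * δ := by gcongr
  refine le_of_mul_le_mul_right (a := |B|) ?_ hBpos
  linarith

theorem zero_differences_near_half_integers :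
    ∃ C R₀ : ℝ, 0 < C ∧ 0 < R₀ ∧
      ∀ r s : ℝ, R₀ ≤ r → r ≤ s → fDisk r = 0 → fDisk s = 0 →
        ∃ j : ℕ, |(s - r) - (j : ℝ) / 2| ≤ C * (s - r + 1) / r ^ 2 := by
  refine ⟨1, 1, one_pos, one_pos, fun r s hr hrs hfr hfs => ?_⟩
  have hr0 : 0 < r := by linarith
  obtain ⟨j, hj1, hj2⟩ := exists_nat_abs_sub_half_le (sub_nonneg.2 hrs)
  refine ⟨j, ?_⟩
  rcases le_total (s - r) (r ^ 2) with h | h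
  · have h1 := abs_sin_zero_sub_le hr0 hrs (diskCosIntegral_eq_zero_of_fDisk_eq_zero hfr)
      (diskCosIntegral_eq_zero_of_fDisk_eq_zero hfs) h
    have h2 : (s - r) / r ^ 2 ≤ 1 * (s - r + 1) / r ^ 2 := by gcongr; linarith
    linarith [abs_nonneg (s - r - (j : ℝ) / 2)]
  · have h1 : 1 ≤ 1 * (s - r + 1) / r ^ 2 := by
      rw [le_div_iff₀ (by positivity)]; linarith
    linarith
end
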